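/- Let d, n ≥ 1 and 1 < p < ∞, and let W be a matrix A₁ weight on ℝ^d. Then the maximal operator M'_{W,p} built from reducing operators is bounded from L^p(ℝ^d; ℂⁿ) to L^p(ℝ^d): there is a constant c depending only on n, d, p such that ‖M'_{W,p} f‖_{L^p(ℝ^d)} ≤ c · [W]_{A₁}^{1/p} · ‖f‖_{L^p(ℝ^d;ℂⁿ)} for every f ∈ L^p(ℝ^d; ℂⁿ). -/

import Mathlib

open MeasureTheory ENNReal
open scoped ComplexOrder

noncomputable section

abbrev Rd (d : ℕ) := EuclideanSpace ℝ (Fin d)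
abbrev Mat (n : ℕ) := Matrix (Fin n) (Fin n) ℂ
abbrev Vec (n : ℕ) := EuclideanSpace ℂ (Fin n)

/-- A cube in `ℝ^d` with sides parallel to the coordinate axes, given by its
lower-left corner and (positive) side length. -/
structure Cube (d : ℕ) where
  corner : Rd d
  side : ℝ
  side_pos : 0 < side

namespace Cube

/-- The underlying set of the cube. -/
def set {d : ℕ} (Q : Cube d) : Set (Rd d) :=
  {x | ∀ i, Q.corner i ≤ x i ∧ x i ≤ Q.corner i + Q.side}

/-- The concentric triple `3Q` of a cube. -/
def triple {d : ℕ} (Q : Cube d) : Set (Rd d) :=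
  {x | ∀ i, Q.corner i - Q.side ≤ x i ∧ x i ≤ Q.corner i + 2 * Q.side}

end Cube

/-- Operator norm of an `n × n` complex matrix acting on `ℂⁿ` with the Euclidean norm. -/
def opNorm {n : ℕ} (A : Mat n) : ℝ := ‖Matrix.toEuclideanCLM (𝕜 := ℂ) (n := Fin n) A‖

/-- A matrix acting on a Euclidean vector. -/
def mvec {n : ℕ} (A : Mat n) (v : Vec n) : Vec n := Matrix.toEuclideanLin A v

/-- Fractional power of a Hermitian matrix via the spectral calculus (junk value `1`
for non-Hermitian matrices). -/
def matPow {n : ℕ} (A : Mat n) (s : ℝ) : Mat n :=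
  if h : A.IsHermitian then
    (h.eigenvectorUnitary : Mat n) *
      Matrix.diagonal (fun i => ((h.eigenvalues i ^ s : ℝ) : ℂ)) *
      star (h.eigenvectorUnitary : Mat n)
  else 1

/-- A matrix weight: measurable, positive definite (hence Hermitian) a.e. -/
def IsMatrixWeight {d n : ℕ} (W : Rd d → Mat n) : Prop :=
  (∀ i j, Measurable fun x => W x i j) ∧ ∀ᵐ x : Rd d, (W x).PosDef


/-- Componentwise measurability of a `ℂⁿ`-valued function. -/
def MeasurableV {d n : ℕ} (f : Rd d → Vec n) : Prop := ∀ i, Measurable fun x => f x i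
/-- The matrix `A₁` characteristic of `W`. -/
def A1Const {d n : ℕ} (W : Rd d → Mat n) : ℝ≥0∞ :=
  ⨆ Q : Cube d,
    essSup (fun y => (volume Q.set)⁻¹ *
      ∫⁻ x in Q.set, ENNReal.ofReal (opNorm (W x * (W y)⁻¹))) (volume.restrict Q.set)

/-- The matrix `A_q` characteristic of `W`, `1 < q < ∞`. -/
def AqConst {d n : ℕ} (W : Rd d → Mat n) (q : ℝ) : ℝ≥0∞ :=
  ⨆ Q : Cube d, (volume Q.set)⁻¹ * ∫⁻ x in Q.set,
    ((volume Q.set)⁻¹ * ∫⁻ y in Q.set,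
        ENNReal.ofReal (opNorm (matPow (W x) (1/q) * matPow (W y) (-(1/q)))) ^ (q/(q-1))) ^ (q-1)

/-- Hardy–Littlewood maximal operator (over cubes) of an `ℝ≥0∞`-valued function. -/
def HLM {d : ℕ} (g : Rd d → ℝ≥0∞) (x : Rd d) : ℝ≥0∞ :=
  ⨆ (Q : Cube d) (_ : x ∈ Q.set), (volume Q.set)⁻¹ * ∫⁻ y in Q.set, g y

/-- The Fujii–Wilson `A∞` characteristic of a scalar weight `w`. -/
def AInftyConst {d : ℕ} (w : Rd d → ℝ≥0∞) : ℝ≥0∞ :=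
  ⨆ Q : Cube d, (∫⁻ x in Q.set, w x)⁻¹ * ∫⁻ x in Q.set, HLM (Q.set.indicator w) x

/-- The scalar `A_{q,∞}` characteristic of a matrix weight `W`. -/
def AqScConst {d n : ℕ} (W : Rd d → Mat n) (q : ℝ) : ℝ≥0∞ :=
  ⨆ e : Vec n, AInftyConst (fun x => (‖mvec (matPow (W x) (1/q)) e‖₊ : ℝ≥0∞) ^ q)

/-- `L^p` norm of an `ℝ≥0∞`-valued function. -/
def lpNormE {d : ℕ} (p : ℝ) (g : Rd d → ℝ≥0∞) : ℝ≥0∞ := (∫⁻ x, g x ^ p) ^ (1/p)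

/-- `L^p` norm of a `ℂⁿ`-valued function. -/
def lpNormV {d n : ℕ} (p : ℝ) (f : Rd d → Vec n) : ℝ≥0∞ :=
  (∫⁻ x, (‖f x‖₊ : ℝ≥0∞) ^ p) ^ (1/p)

/-- The weighted norm `‖f‖_{L^p(W)}`. -/
def lpWNorm {d n : ℕ} (p : ℝ) (W : Rd d → Mat n) (f : Rd d → Vec n) : ℝ≥0∞ :=
  (∫⁻ x, (‖mvec (matPow (W x) (1/p)) (f x)‖₊ : ℝ≥0∞) ^ p) ^ (1/p)


/-- The averaging norm `ρ_{W,p,Q}` whose reducing operator is `𝒲_{Q,p}`. -/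
def reducingNorm {d n : ℕ} (W : Rd d → Mat n) (p : ℝ) (Q : Cube d) (e : Vec n) : ℝ≥0∞ :=
  ((volume Q.set)⁻¹ * ∫⁻ t in Q.set, (‖mvec (matPow (W t) (1/p)) e‖₊ : ℝ≥0∞) ^ p) ^ (1/p)

/-- `R` is a family of reducing operators for `W`, `p`. -/
def IsReducingFamily {d n : ℕ} (W : Rd d → Mat n) (p : ℝ) (R : Cube d → Mat n) : Prop :=
  ∀ Q : Cube d, (R Q).PosDef ∧ ∀ e : Vec n,
    reducingNorm W p Q e ≤ (‖mvec (R Q) e‖₊ : ℝ≥0∞) ∧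
    (‖mvec (R Q) e‖₊ : ℝ≥0∞) ≤ ENNReal.ofReal (Real.sqrt n) * reducingNorm W p Q e

/-- The maximal operator `M'_{W,p}` built from the reducing operators `R Q = 𝒲_{Q,p}`. -/
def MWpPrime {d n : ℕ} (R : Cube d → Mat n) (W : Rd d → Mat n) (p : ℝ)
    (f : Rd d → Vec n) (x : Rd d) : ℝ≥0∞ :=
  ⨆ (Q : Cube d) (_ : x ∈ Q.set),
    (volume Q.set)⁻¹ *
      ∫⁻ y in Q.set, (‖mvec (R Q * matPow (W y) (-(1/p))) (f y)‖₊ : ℝ≥0∞)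

section MatrixPowers

open scoped NNReal MatrixOrder Matrix.Norms.L2Operator

variable {A : Type*} [CStarAlgebra A] [PartialOrder A] [StarOrderedRing A]

theorem CFC.smul_rpow {a : A} (ha : 0 ≤ a) (t : ℝ≥0) (s : ℝ) (hs : 0 ≤ s) :
    (t • a) ^ s = t ^ s • a ^ s := by
  have hc (u : Set ℝ≥0) : ContinuousOn (fun x : ℝ≥0 => x ^ s) u :=
    (NNReal.continuous_rpow_const hs).continuousOn
  rw [CFC.rpow_def, CFC.rpow_def, ← cfc_comp_smul t (fun x : ℝ≥0 => x ^ s) a (hc _),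
    ← cfc_smul (t ^ s) (fun x : ℝ≥0 => x ^ s) a (hc _)]
  simp only [smul_eq_mul, NNReal.mul_rpow]

theorem CFC.norm_rpow_mul_rpow_neg_le_one {a b : A} (ha : 0 ≤ a) (hb : IsStrictlyPositive b)
    {s : ℝ} (hs0 : 0 < s) (hs1 : s ≤ 1) (h : ‖a * b ^ (-1 : ℝ)‖ ≤ 1) :
    ‖a ^ s * b ^ (-s)‖ ≤ 1 := by
  have sp (x : ℝ) : IsStrictlyPositive (b ^ x) :=
    IsStrictlyPositive.iff_of_unital.mpr ⟨CFC.rpow_nonneg, hb.isUnit.cfcRpow x hb.nonneg⟩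
  have h1 : a ^ (2 : ℝ) ≤ b ^ (2 : ℝ) := by
    rw [le_iff_norm_sqrt_mul_rpow _ _ CFC.rpow_nonneg (sp _), CFC.sqrt_eq_rpow,
      CFC.rpow_rpow_of_exponent_nonneg a _ _ (by norm_num) (by norm_num),
      CFC.rpow_rpow b _ _ (by norm_num) hb]
    norm_num [CFC.rpow_one a ha]
    exact h
  have h2 := CFC.rpow_le_rpow (p := s) ⟨hs0.le, hs1⟩ h1
  rw [CFC.rpow_rpow_of_exponent_nonneg a _ _ (by norm_num) hs0.le,
      CFC.rpow_rpow b _ _ (by norm_num) hb,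
    le_iff_norm_sqrt_mul_rpow _ _ CFC.rpow_nonneg (sp _), CFC.sqrt_eq_rpow,
      CFC.rpow_rpow_of_exponent_nonneg a _ _ (by positivity) (by norm_num),
      CFC.rpow_rpow b _ _ (by positivity) hb] at h2
  convert h2 using 4 <;> ring

/-- **Cordes inequality**. -/
theorem CFC.norm_rpow_mul_rpow_neg_le {a b : A} (ha : 0 ≤ a) (hb : IsStrictlyPositive b)
    {s : ℝ} (hs0 : 0 < s) (hs1 : s ≤ 1) :
    ‖a ^ s * b ^ (-s)‖ ≤ ‖a * b ^ (-1 : ℝ)‖ ^ s := by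
  rcases eq_or_ne (a * b ^ (-1 : ℝ)) 0 with h0 | h0
  · have : a = 0 := by
      have := CFC.rpow_neg_mul_rpow (a := b) 1 hb
      rw [← mul_one a, ← this, ← mul_assoc, h0, zero_mul]
    subst this
    have : (0 : A) ^ s = 0 := CFC.zero_rpow hs0.ne'
    simp [this, hs0.ne']
  · set t : ℝ≥0 := ‖a * b ^ (-1 : ℝ)‖₊ with ht
    have ht0 : t ≠ 0 := by simpa [ht] using h0
    have h1 : ‖(t⁻¹ • a) * b ^ (-1 : ℝ)‖ ≤ 1 := by
      rw [smul_mul_assoc, NNReal.smul_def, norm_smul]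
      rw [← coe_nnnorm (a * b ^ (-1 : ℝ)), ← ht]
      simp [ht0]
    have h2 := CFC.norm_rpow_mul_rpow_neg_le_one (smul_nonneg zero_le ha) hb hs0 hs1 h1
    rw [CFC.smul_rpow ha _ _ hs0.le, smul_mul_assoc, NNReal.smul_def, norm_smul,
      NNReal.inv_rpow] at h2
    have : 0 < t ^ s := NNReal.rpow_pos (pos_iff_ne_zero.mpr ht0)
    have h3 : (0 : ℝ) < (t ^ s : ℝ≥0) := by exact_mod_cast this
    rw [← coe_nnnorm (a * b ^ (-1 : ℝ)), ← ht]
    simp only [NNReal.coe_inv, norm_inv, Real.norm_of_nonneg h3.le] at h2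
    rw [inv_mul_le_iff₀ h3, mul_one] at h2
    exact_mod_cast h2

theorem matPow_eq_rpow {n : ℕ} {A : Mat n} (hA : A.PosSemidef) (s : ℝ) : matPow A s = A ^ s := by
  rw [CFC.rpow_eq_cfc_real (Matrix.nonneg_iff_posSemidef.mpr hA), hA.isHermitian.cfc_eq]
  simp only [matPow, hA.isHermitian, dite_true, Matrix.IsHermitian.cfc,
    Unitary.conjStarAlgAut_apply]
  rfl

theorem opNorm_matPow_mul_matPow_neg_le {n : ℕ} {A B : Mat n} (hA : A.PosDef) (hB : B.PosDef)
    {s : ℝ} (hs0 : 0 < s) (hs1 : s ≤ 1) :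
    opNorm (matPow A s * matPow B (-s)) ≤ opNorm (A * B⁻¹) ^ s := by
  have hB' : IsStrictlyPositive B := Matrix.isStrictlyPositive_iff_posDef.mpr hB
  have hinv : B ^ (-1 : ℝ) = B⁻¹ := by
    refine (Matrix.inv_eq_left_inv ?_).symm
    nth_rw 2 [← CFC.rpow_one B hB'.nonneg]
    exact CFC.rpow_neg_mul_rpow 1 hB'
  rw [matPow_eq_rpow hA.posSemidef, matPow_eq_rpow hB.posSemidef, ← hinv]
  exact CFC.norm_rpow_mul_rpow_neg_le (Matrix.nonneg_iff_posSemidef.mpr hA.posSemidef) hB' hs0 hs1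

end MatrixPowers

theorem mvec_mul {n : ℕ} (A B : Mat n) (v : Vec n) : mvec (A * B) v = mvec A (mvec B v) := by
  simp [mvec, Matrix.toLpLin_mul_same]

theorem norm_mvec_le {n : ℕ} (A : Mat n) (v : Vec n) : ‖mvec A v‖ ≤ opNorm A * ‖v‖ :=
  (Matrix.toEuclideanCLM (𝕜 := ℂ) (n := Fin n) A).le_opNorm v

theorem enorm_mvec_matPow_rpow_le {n : ℕ} {A B : Mat n} (hA : A.PosDef) (hB : B.PosDef)
    {p : ℝ} (hp : 1 < p) (v : Vec n) :
    (‖mvec (matPow A (1 / p)) (mvec (matPow B (-(1 / p))) v)‖₊ : ℝ≥0∞) ^ p ≤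
      ENNReal.ofReal (opNorm (A * B⁻¹)) * (‖v‖₊ : ℝ≥0∞) ^ p := by
  have hp0 : 0 < p := by linarith
  have h0 : 0 ≤ opNorm (A * B⁻¹) := norm_nonneg _
  have h : ‖mvec (matPow A (1 / p)) (mvec (matPow B (-(1 / p))) v)‖ ≤
      opNorm (A * B⁻¹) ^ (1 / p) * ‖v‖ := by
    rw [← mvec_mul]
    refine (norm_mvec_le _ _).trans ?_
    gcongr
    exact opNorm_matPow_mul_matPow_neg_le hA hB (by positivity) ((div_le_one hp0).mpr hp.le)
  rw [← enorm_eq_nnnorm, ← enorm_eq_nnnorm, ← ofReal_norm, ← ofReal_norm,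
    ENNReal.ofReal_rpow_of_nonneg (norm_nonneg _) hp0.le,
    ENNReal.ofReal_rpow_of_nonneg (norm_nonneg _) hp0.le, ← ENNReal.ofReal_mul h0]
  refine ENNReal.ofReal_le_ofReal ((Real.rpow_le_rpow (norm_nonneg _) h hp0.le).trans_eq ?_)
  rw [Real.mul_rpow (by positivity) (norm_nonneg _), ← Real.rpow_mul h0, one_div,
    inv_mul_cancel₀ hp0.ne', Real.rpow_one]

/-- The pointwise bound of the averages defining `MWpPrime` by those of `‖f‖`. -/
theorem ae_enorm_mvec_reducing_le {d n : ℕ} {p : ℝ} (hp : 1 < p) {W : Rd d → Mat n}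
    (hW : ∀ᵐ x, (W x).PosDef) {R : Cube d → Mat n} (hR : IsReducingFamily W p R) (f : Rd d → Vec n)
    (Q : Cube d) :
    ∀ᵐ y ∂volume.restrict Q.set,
      (‖mvec (R Q * matPow (W y) (-(1 / p))) (f y)‖₊ : ℝ≥0∞) ≤
        ENNReal.ofReal (Real.sqrt n) * A1Const W ^ (1 / p) * ‖f y‖₊ := by
  have hp0 : 0 < p := by linarith
  have hess := ENNReal.ae_le_essSup (μ := volume.restrict Q.set) (fun y => (volume Q.set)⁻¹ *
      ∫⁻ x in Q.set, ENNReal.ofReal (opNorm (W x * (W y)⁻¹)))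
  filter_upwards [ae_restrict_of_ae hW, hess] with y hy hyess
  have hA1 := hyess.trans (le_iSup (fun Q : Cube d => essSup (fun y => (volume Q.set)⁻¹ *
      ∫⁻ x in Q.set, ENNReal.ofReal (opNorm (W x * (W y)⁻¹))) (volume.restrict Q.set)) Q)
  change _ ≤ A1Const W at hA1
  rw [mvec_mul, mul_assoc]
  refine ((hR Q).2 _).2.trans ?_
  gcongr
  rw [reducingNorm]
  calc _ ≤ ((volume Q.set)⁻¹ * ∫⁻ t in Q.set,
        ENNReal.ofReal (opNorm (W t * (W y)⁻¹)) * (‖f y‖₊ : ℝ≥0∞) ^ p) ^ (1 / p) := by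
        gcongr ?_ ^ _
        refine mul_le_mul' le_rfl (lintegral_mono_ae ?_)
        filter_upwards [ae_restrict_of_ae hW] with t ht
        exact enorm_mvec_matPow_rpow_le ht hy hp (f y)
    _ ≤ (A1Const W * (‖f y‖₊ : ℝ≥0∞) ^ p) ^ (1 / p) := by
        rw [lintegral_mul_const' _ _ (by finiteness), ← mul_assoc]
        gcongr
    _ = _ := by
        rw [ENNReal.mul_rpow_of_nonneg _ _ (by positivity), ← ENNReal.rpow_mul,
          mul_one_div_cancel hp0.ne',
          ENNReal.rpow_one]

theorem MWpPrime_le {d n : ℕ} {p : ℝ} (hp : 1 < p) {W : Rd d → Mat n}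
    (hW : ∀ᵐ x, (W x).PosDef) (hA : A1Const W ≠ ⊤) {R : Cube d → Mat n}
    (hR : IsReducingFamily W p R) (f : Rd d → Vec n) (x : Rd d) :
    MWpPrime R W p f x ≤
      ENNReal.ofReal (Real.sqrt n) * A1Const W ^ (1 / p) * HLM (fun y => (‖f y‖₊ : ℝ≥0∞)) x := by
  have hp0 : 0 < p := by linarith
  refine iSup₂_le fun Q hx => ?_
  have hfin : ENNReal.ofReal (Real.sqrt n) * A1Const W ^ (1 / p) ≠ ⊤ :=
    ENNReal.mul_ne_top ENNReal.ofReal_ne_top (ENNReal.rpow_ne_top_of_nonneg (by positivity) hA)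
  calc _ ≤ (volume Q.set)⁻¹ * ∫⁻ y in Q.set,
        ENNReal.ofReal (Real.sqrt n) * A1Const W ^ (1 / p) * ‖f y‖₊ := by
        exact mul_le_mul' le_rfl (lintegral_mono_ae (ae_enorm_mvec_reducing_le hp hW hR f Q))
    _ = ENNReal.ofReal (Real.sqrt n) * A1Const W ^ (1 / p) *
        ((volume Q.set)⁻¹ * ∫⁻ y in Q.set, ‖f y‖₊) := by
        rw [lintegral_const_mul' _ _ hfin, mul_left_comm]
    _ ≤ _ := by
        gcongr
        exact le_iSup₂ (f := fun (Q : Cube d) (_ : x ∈ Q.set) =>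
          (volume Q.set)⁻¹ * ∫⁻ y in Q.set, (‖f y‖₊ : ℝ≥0∞)) Q hx

section MaximalFunction

open Metric Set

/-- Uncentered Hardy–Littlewood maximal function over open Euclidean balls. -/
def ballMaximal {d : ℕ} (g : Rd d → ℝ≥0∞) (x : Rd d) : ℝ≥0∞ :=
  ⨆ (c : Rd d) (r : ℝ) (_ : x ∈ ball c r), (volume (ball c r))⁻¹ * ∫⁻ y in ball c r, g y

theorem lt_ballMaximal_iff {d : ℕ} {g : Rd d → ℝ≥0∞} {x : Rd d} {t : ℝ≥0∞} :
    t < ballMaximal g x ↔ ∃ c r, x ∈ ball c r ∧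
      t < (volume (ball c r))⁻¹ * ∫⁻ y in ball c r, g y := by
  simp only [ballMaximal, lt_iSup_iff, exists_prop]

theorem isOpen_lt_ballMaximal {d : ℕ} (g : Rd d → ℝ≥0∞) (t : ℝ≥0∞) :
    IsOpen {x | t < ballMaximal g x} := by
  have : {x | t < ballMaximal g x} = ⋃ (c : Rd d) (r : ℝ)
      (_ : t < (volume (ball c r))⁻¹ * ∫⁻ y in ball c r, g y), ball c r := by
    ext x
    simp only [mem_ofPred_eq, lt_ballMaximal_iff, mem_iUnion, exists_prop, and_comm]
  rw [this]
  exact isOpen_iUnion fun c => isOpen_iUnion fun r => isOpen_iUnion fun _ => isOpen_ball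

theorem measurable_ballMaximal {d : ℕ} (g : Rd d → ℝ≥0∞) : Measurable (ballMaximal g) :=
  measurable_of_Ioi fun t => (isOpen_lt_ballMaximal g t).measurableSet

theorem ballMaximal_le_add {d : ℕ} {g h : Rd d → ℝ≥0∞} {t : ℝ≥0∞} (hgh : ∀ y, g y ≤ h y + t)
    (x : Rd d) : ballMaximal g x ≤ ballMaximal h x + t := by
  refine iSup_le fun c => iSup₂_le fun r hx => ?_
  have hr : 0 < r := pos_of_mem_ball hx
  calc _ ≤ (volume (ball c r))⁻¹ * ∫⁻ y in ball c r, (h y + t) := by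
        gcongr with y
        exact hgh y
    _ = (volume (ball c r))⁻¹ * (∫⁻ y in ball c r, h y) + t := by
        rw [lintegral_add_right _ measurable_const, mul_add, setLIntegral_const, mul_comm t,
          ← mul_assoc, ENNReal.inv_mul_cancel (measure_ball_pos _ _ hr).ne' measure_ball_lt_top.ne,
          one_mul]
    _ ≤ _ := by
        gcongr
        exact le_iSup_of_le c (le_iSup₂_of_le r hx le_rfl)

/-- The weak type `(1, 1)` inequality. -/
theorem measure_lt_ballMaximal_le {d : ℕ} (hd : 1 ≤ d) (g : Rd d → ℝ≥0∞) {t : ℝ≥0∞} (ht : t ≠ 0)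
    (ht' : t ≠ ⊤) :
    t * volume {x | t < ballMaximal g x} ≤ 5 ^ d * ∫⁻ y, g y := by
  by_cases hg : ∫⁻ y, g y = ⊤
  · rw [hg, ENNReal.mul_top (by positivity)]
    exact le_top
  set v : ℝ≥0∞ := volume (ball (0 : Rd d) 1) with hv
  have hv0 : v ≠ 0 := (measure_ball_pos _ _ one_pos).ne'
  have hv' : v ≠ ⊤ := measure_ball_lt_top.ne
  let S : Set (Rd d × ℝ) := {q | 0 < q.2 ∧
    t < (volume (ball q.1 q.2))⁻¹ * ∫⁻ y in ball q.1 q.2, g y}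
  have hvol (q : Rd d × ℝ) (hq : q ∈ S) :
      t * volume (ball q.1 q.2) ≤ ∫⁻ y in ball q.1 q.2, g y := by
    have h0 := (measure_ball_pos volume q.1 hq.1).ne'
    have h1 : volume (ball q.1 q.2) ≠ ⊤ := measure_ball_lt_top.ne
    have := hq.2.le
    rwa [mul_comm, ← div_eq_mul_inv, ENNReal.le_div_iff_mul_le (.inl h0) (.inl h1)] at this
  have hbd (q : Rd d × ℝ) (hq : q ∈ S) : q.2 ≤ max 1 ((∫⁻ y, g y) / (t * v)).toReal := by
    by_contra! hlt
    obtain ⟨h1, h2⟩ := max_lt_iff.mp hlt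
    have h3 : ENNReal.ofReal q.2 * (t * v) ≤ ∫⁻ y, g y := by
      calc _ ≤ ENNReal.ofReal (q.2 ^ d) * (t * v) := by
            gcongr
            exact le_self_pow₀ h1.le (by omega)
        _ = t * volume (ball q.1 q.2) := by
            rw [Measure.addHaar_ball_of_pos _ _ hq.1, finrank_euclideanSpace_fin, mul_left_comm]
        _ ≤ _ := (hvol q hq).trans (setLIntegral_le_lintegral _ _)
    rw [← ENNReal.le_div_iff_mul_le (.inl (mul_ne_zero ht hv0)) (.inl (ENNReal.mul_ne_top ht' hv'))]
      at h3
    have hfin : (∫⁻ y, g y) / (t * v) ≠ ⊤ := ENNReal.div_ne_top hg (mul_ne_zero ht hv0)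
    exact absurd ((ENNReal.ofReal_le_iff_le_toReal hfin).mp h3) (not_le.mpr h2)
  obtain ⟨u, huS, hdisj, hcov⟩ := Vitali.exists_disjoint_subfamily_covering_enlargement_closedBall
    S Prod.fst Prod.snd _ hbd 5 (by norm_num)
  have hdisj' : u.PairwiseDisjoint fun q => ball q.1 q.2 :=
    hdisj.mono fun q => ball_subset_closedBall
  have hcount : u.Countable := hdisj'.countable_of_isOpen (fun q _ => isOpen_ball)
    fun q hq => ⟨q.1, mem_ball_self (huS hq).1⟩
  have hsub : {x | t < ballMaximal g x} ⊆ ⋃ q ∈ u, closedBall q.1 (5 * q.2) := by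
    intro x hx
    obtain ⟨c, r, hxr, hlt⟩ := lt_ballMaximal_iff.mp hx
    obtain ⟨b, hb, hb'⟩ := hcov (c, r) ⟨pos_of_mem_ball hxr, hlt⟩
    exact mem_biUnion hb (hb' (ball_subset_closedBall hxr))
  calc t * volume {x | t < ballMaximal g x}
      ≤ t * ∑' q : u, volume (closedBall q.1.1 (5 * q.1.2)) := by
        gcongr
        exact (measure_mono hsub).trans (measure_biUnion_le _ hcount _)
    _ = ∑' q : u, 5 ^ d * (t * volume (ball q.1.1 q.1.2)) := by
        rw [← ENNReal.tsum_mul_left]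
        refine tsum_congr fun q => ?_
        have hq := (huS q.2).1
        rw [Measure.addHaar_closedBall _ _ (by positivity), Measure.addHaar_ball_of_pos _ _ hq,
          finrank_euclideanSpace_fin, mul_pow, ENNReal.ofReal_mul (by positivity),
          ENNReal.ofReal_pow (by norm_num)]
        norm_num
        ring
    _ ≤ ∑' q : u, 5 ^ d * ∫⁻ y in ball q.1.1 q.1.2, g y := by
        gcongr with q
        exact hvol q (huS q.2)
    _ = 5 ^ d * ∫⁻ y in ⋃ q ∈ u, ball q.1 q.2, g y := by
        rw [ENNReal.tsum_mul_left, lintegral_biUnion hcount (fun _ _ => measurableSet_ball) hdisj']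
    _ ≤ _ := mul_le_mul' le_rfl (setLIntegral_le_lintegral _ _)

theorem lintegral_Ioo_rpow {s : ℝ} (hs : 0 < s) {b : ℝ} (hb : 0 ≤ b) :
    ∫⁻ t in Ioo 0 b, ENNReal.ofReal (s * t ^ (s - 1)) = ENNReal.ofReal b ^ s := by
  have hint : IntervalIntegrable (fun t : ℝ => s * t ^ (s - 1)) volume 0 b :=
    (intervalIntegral.intervalIntegrable_rpow' (by linarith)).const_mul s
  rw [← restrict_Ioo_eq_restrict_Ioc.symm, ← ofReal_integral_eq_lintegral_ofReal,
    ← intervalIntegral.integral_of_le hb, intervalIntegral.integral_const_mul,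
    integral_rpow (.inl (by linarith)), ENNReal.ofReal_rpow_of_nonneg hb hs.le]
  · congr 1
    simp [Real.zero_rpow hs.ne']
    field_simp
  · exact (intervalIntegrable_iff_integrableOn_Ioc_of_le hb).mp hint
  · filter_upwards [ae_restrict_mem measurableSet_Ioc] with t ht
    have := ht.1
    positivity

theorem lintegral_Ioi_indicator_lt_rpow {s : ℝ} (hs : 0 < s) (m : ℝ≥0∞) :
    ∫⁻ t in Ioi (0 : ℝ), (if ENNReal.ofReal t < m then ENNReal.ofReal (s * t ^ (s - 1)) else 0) =
      m ^ s := by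
  have key (b : ℝ) (hb : 0 ≤ b) : ∫⁻ t in Ioi (0 : ℝ),
      (if ENNReal.ofReal t < ENNReal.ofReal b then ENNReal.ofReal (s * t ^ (s - 1)) else 0) =
        ENNReal.ofReal b ^ s := by
    rw [← lintegral_Ioo_rpow hs hb, ← Ioi_inter_Iio, inter_comm,
      ← Measure.restrict_restrict measurableSet_Iio, ← lintegral_indicator measurableSet_Iio]
    refine setLIntegral_congr_fun measurableSet_Ioi fun t ht => ?_
    simp only [indicator, mem_Iio, ENNReal.ofReal_lt_ofReal_iff_of_nonneg (le_of_lt ht)]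
  rcases eq_or_ne m ⊤ with rfl | hm
  · rw [ENNReal.top_rpow_of_pos hs]
    refine ENNReal.eq_top_of_forall_nnreal_le fun r => ?_
    have h := key ((r : ℝ) ^ s⁻¹) (by positivity)
    rw [ENNReal.ofReal_rpow_of_nonneg (by positivity) hs.le, Real.rpow_inv_rpow r.coe_nonneg hs.ne',
      ENNReal.ofReal_coe_nnreal] at h
    rw [← h]
    refine lintegral_mono fun t => ?_
    simp only [ENNReal.ofReal_lt_top, if_true]
    split_ifs <;> simp
  · rw [← ENNReal.ofReal_toReal hm]
    exact key _ ENNReal.toReal_nonneg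

/-- Layer-cake formula for `ℝ≥0∞`-valued functions. -/
theorem lintegral_rpow_eq_lintegral_measure_lt {α : Type*} [MeasurableSpace α] {μ : Measure α}
    [SFinite μ] {F : α → ℝ≥0∞} (hF : Measurable F) {s : ℝ} (hs : 0 < s) :
    ∫⁻ x, F x ^ s ∂μ =
      ∫⁻ t in Ioi (0 : ℝ), ENNReal.ofReal (s * t ^ (s - 1)) * μ {x | ENNReal.ofReal t < F x} := by
  simp_rw [← lintegral_Ioi_indicator_lt_rpow hs]
  rw [lintegral_lintegral_swap]
  · refine lintegral_congr fun t => ?_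
    have hm : MeasurableSet {x | ENNReal.ofReal t < F x} := measurableSet_lt measurable_const hF
    rw [← lintegral_indicator_const hm]
    simp only [indicator, mem_ofPred_eq]
  · refine Measurable.aemeasurable (Measurable.ite ?_ (by fun_prop) measurable_const)
    exact measurableSet_lt (by fun_prop) (hF.comp measurable_fst)

/-- The strong type `(p, p)` inequality for the maximal function over balls. -/
theorem lintegral_ballMaximal_rpow_le {d : ℕ} (hd : 1 ≤ d) {p : ℝ} (hp : 1 < p)
    {g : Rd d → ℝ≥0∞} (hg : Measurable g) :
    ∫⁻ x, ballMaximal g x ^ p ≤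
      ENNReal.ofReal (p / (p - 1)) * (2 * 5 ^ d) * 2 ^ (p - 1) * ∫⁻ x, g x ^ p := by
  have hp1 : 0 < p - 1 := by linarith
  set K : ℝ≥0∞ := ENNReal.ofReal (p / (p - 1)) * (2 * 5 ^ d) with hK
  have hKtop : K ≠ ⊤ := by finiteness
  have hcut (t : ℝ) (ht : 0 < t) : ENNReal.ofReal t * volume {x | ENNReal.ofReal t < ballMaximal g x}
      ≤ 2 * 5 ^ d * ∫⁻ x, if ENNReal.ofReal t < 2 * g x then g x else 0 := by
    set h : Rd d → ℝ≥0∞ := fun x => if ENNReal.ofReal t < 2 * g x then g x else 0 with hh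
    have htwo : ENNReal.ofReal t = 2 * ENNReal.ofReal (t / 2) := by
      rw [show (2 : ℝ≥0∞) = ENNReal.ofReal 2 by simp, ← ENNReal.ofReal_mul (by norm_num)]
      congr 1
      ring
    have hgh (y : Rd d) : g y ≤ h y + ENNReal.ofReal (t / 2) := by
      simp only [hh]
      split_ifs with hy
      · exact le_self_add
      · rw [htwo, not_lt, ENNReal.mul_le_mul_iff_right (by norm_num) (by norm_num)] at hy
        rwa [zero_add]
    have hsub : {x | ENNReal.ofReal t < ballMaximal g x} ⊆
        {x | ENNReal.ofReal (t / 2) < ballMaximal h x} := by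
      intro x hx
      have h1 := lt_of_lt_of_le hx (ballMaximal_le_add hgh x)
      rw [htwo, two_mul] at h1
      exact lt_of_add_lt_add_right h1
    have hweak := measure_lt_ballMaximal_le hd h (t := ENNReal.ofReal (t / 2)) (by simpa using ht)
      ENNReal.ofReal_ne_top
    calc _ ≤ ENNReal.ofReal t * volume {x | ENNReal.ofReal (t / 2) < ballMaximal h x} := by gcongr
      _ = 2 * (ENNReal.ofReal (t / 2) * volume {x | ENNReal.ofReal (t / 2) < ballMaximal h x}) := by
          rw [← mul_assoc, ← htwo]
      _ ≤ 2 * (5 ^ d * ∫⁻ x, h x) := mul_le_mul' le_rfl hweak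
      _ = _ := (mul_assoc _ _ _).symm
  calc ∫⁻ x, ballMaximal g x ^ p
      = ∫⁻ t in Ioi (0 : ℝ), ENNReal.ofReal (p * t ^ (p - 1)) *
          volume {x | ENNReal.ofReal t < ballMaximal g x} :=
        lintegral_rpow_eq_lintegral_measure_lt (measurable_ballMaximal g) (by linarith)
    _ ≤ ∫⁻ t in Ioi (0 : ℝ), K * ∫⁻ x, g x *
          (if ENNReal.ofReal t < 2 * g x then ENNReal.ofReal ((p - 1) * t ^ (p - 1 - 1)) else 0) := by
        refine setLIntegral_mono' measurableSet_Ioi fun t ht => ?_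
        have ht : 0 < t := ht
        have hsplit : ENNReal.ofReal (p * t ^ (p - 1)) = ENNReal.ofReal (p / (p - 1)) *
            ENNReal.ofReal ((p - 1) * t ^ (p - 1 - 1)) * ENNReal.ofReal t := by
          rw [← ENNReal.ofReal_mul (by positivity), ← ENNReal.ofReal_mul (by positivity),
            Real.rpow_sub_one ht.ne' (p - 1)]
          congr 1
          field_simp
        calc _ ≤ ENNReal.ofReal (p / (p - 1)) * ENNReal.ofReal ((p - 1) * t ^ (p - 1 - 1)) *
              (2 * 5 ^ d * ∫⁻ x, if ENNReal.ofReal t < 2 * g x then g x else 0) := by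
              rw [hsplit, mul_assoc]
              exact mul_le_mul' le_rfl (hcut t ht)
          _ = K * (ENNReal.ofReal ((p - 1) * t ^ (p - 1 - 1)) *
              ∫⁻ x, if ENNReal.ofReal t < 2 * g x then g x else 0) := by
              rw [hK]
              ring
          _ = _ := by
              rw [← lintegral_const_mul' _ _ ENNReal.ofReal_ne_top]
              congr 1
              refine lintegral_congr fun x => ?_
              split_ifs
              · exact mul_comm _ _
              · simp
    _ = K * ∫⁻ x, g x * (2 * g x) ^ (p - 1) := by
        rw [lintegral_const_mul' _ _ hKtop, lintegral_lintegral_swap]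
        · congr 1
          refine lintegral_congr fun x => ?_
          rw [← lintegral_Ioi_indicator_lt_rpow hp1 (2 * g x), lintegral_const_mul]
          exact Measurable.ite (measurableSet_lt (by fun_prop) measurable_const) (by fun_prop)
            measurable_const
        · refine Measurable.aemeasurable ((hg.comp measurable_snd).mul
            (Measurable.ite ?_ (by fun_prop) measurable_const))
          exact measurableSet_lt (by fun_prop) ((hg.comp measurable_snd).const_mul 2)
    _ = K * (2 ^ (p - 1) * ∫⁻ x, g x ^ p) := by
        rw [← lintegral_const_mul' (2 ^ (p - 1)) _ (by finiteness)]
        congr 1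
        refine lintegral_congr fun x => ?_
        rw [ENNReal.mul_rpow_of_nonneg _ _ hp1.le, mul_left_comm]
        congr 1
        nth_rw 1 [← ENNReal.rpow_one (g x)]
        rw [← ENNReal.rpow_add_of_nonneg _ _ zero_le_one hp1.le, add_sub_cancel]
    _ = _ := (mul_assoc _ _ _).symm

theorem Cube.exists_ball {d : ℕ} (Q : Cube d) :
    ∃ c : Rd d, Q.set ⊆ ball c ((d + 1) * (Q.side / 2)) ∧
      volume (ball c ((d + 1) * (Q.side / 2))) ≤ (d + 1) ^ d * volume Q.set := by
  have hs := Q.side_pos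
  let c : Rd d := WithLp.toLp 2 fun i => Q.corner i + Q.side / 2
  refine ⟨c, fun x hx => ?_, ?_⟩
  · rw [mem_ball, EuclideanSpace.dist_eq, Real.sqrt_lt' (by positivity)]
    have hi (i : Fin d) : dist (x i) (c i) ^ 2 ≤ (Q.side / 2) ^ 2 := by
      have h := hx i
      rw [Real.dist_eq, sq_abs]
      refine sq_le_sq' ?_ ?_ <;> simp only [c] <;> linarith
    calc ∑ i, dist (x i) (c i) ^ 2 ≤ ∑ _i : Fin d, (Q.side / 2) ^ 2 :=
          Finset.sum_le_sum fun i _ => hi i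
      _ = d * (Q.side / 2) ^ 2 := by simp
      _ < (d + 1) ^ 2 * (Q.side / 2) ^ 2 := by
          gcongr
          nlinarith [(Nat.cast_nonneg d : (0 : ℝ) ≤ d)]
      _ = _ := by ring
  · have hsub : ball c (Q.side / 2) ⊆ Q.set := by
      intro x hx i
      have h1 := (PiLp.norm_apply_le (x - c) i).trans_lt (mem_ball_iff_norm.mp hx)
      rw [Real.norm_eq_abs, abs_lt] at h1
      simp only [PiLp.sub_apply, c] at h1
      constructor <;> linarith
    calc _ = (d + 1) ^ d * volume (ball c (Q.side / 2)) := by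
          rw [Measure.addHaar_ball_of_pos _ _ (by positivity),
            Measure.addHaar_ball_of_pos volume c (half_pos hs), finrank_euclideanSpace_fin, mul_pow,
            ENNReal.ofReal_mul (by positivity), mul_assoc,
            ENNReal.ofReal_pow (by positivity : (0 : ℝ) ≤ d + 1),
            ENNReal.ofReal_add (by positivity) (by norm_num), ENNReal.ofReal_natCast,
            ENNReal.ofReal_one]
      _ ≤ _ := by gcongr

theorem HLM_le_ballMaximal {d : ℕ} (g : Rd d → ℝ≥0∞) (x : Rd d) :
    HLM g x ≤ (d + 1) ^ d * ballMaximal g x := by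
  refine iSup₂_le fun Q hx => ?_
  obtain ⟨c, hsub, hvol⟩ := Q.exists_ball
  have h0 : ((d : ℝ≥0∞) + 1) ^ d ≠ 0 := by positivity
  have htop : ((d : ℝ≥0∞) + 1) ^ d ≠ ⊤ := by finiteness
  have hinv : (volume Q.set)⁻¹ ≤ (d + 1) ^ d * (volume (ball c ((d + 1) * (Q.side / 2))))⁻¹ := by
    calc _ = ((d : ℝ≥0∞) + 1) ^ d * ((d + 1) ^ d * volume Q.set)⁻¹ := by
          rw [ENNReal.mul_inv (.inl h0) (.inl htop), ← mul_assoc, ENNReal.mul_inv_cancel h0 htop,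
            one_mul]
      _ ≤ _ := by gcongr
  calc _ ≤ (d + 1) ^ d * (volume (ball c ((d + 1) * (Q.side / 2))))⁻¹ *
        ∫⁻ y in ball c ((d + 1) * (Q.side / 2)), g y :=
        mul_le_mul' hinv (lintegral_mono_set hsub)
    _ ≤ _ := by
        rw [mul_assoc]
        gcongr
        exact le_iSup_of_le c (le_iSup₂_of_le _ (hsub hx) le_rfl)

/-- The Hardy–Littlewood maximal theorem for cubes. -/
theorem lpNormE_HLM_le {d : ℕ} (hd : 1 ≤ d) {p : ℝ} (hp : 1 < p) {g : Rd d → ℝ≥0∞}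
    (hg : Measurable g) :
    lpNormE p (HLM g) ≤
      (d + 1) ^ d * (ENNReal.ofReal (p / (p - 1)) * (2 * 5 ^ d) * 2 ^ (p - 1)) ^ (1 / p) *
        lpNormE p g := by
  have hp0 : 0 < p := by linarith
  have htop : (((d : ℝ≥0∞) + 1) ^ d) ^ p ≠ ⊤ := by finiteness
  calc (∫⁻ x, HLM g x ^ p) ^ (1 / p)
      ≤ (∫⁻ x, (((d : ℝ≥0∞) + 1) ^ d) ^ p * ballMaximal g x ^ p) ^ (1 / p) := by
        gcongr with x
        rw [← ENNReal.mul_rpow_of_nonneg _ _ hp0.le]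
        gcongr
        exact HLM_le_ballMaximal g x
    _ ≤ ((((d : ℝ≥0∞) + 1) ^ d) ^ p * (ENNReal.ofReal (p / (p - 1)) * (2 * 5 ^ d) * 2 ^ (p - 1) *
          ∫⁻ x, g x ^ p)) ^ (1 / p) := by
        rw [lintegral_const_mul' _ _ htop]
        gcongr
        exact lintegral_ballMaximal_rpow_le hd hp hg
    _ = _ := by
        rw [ENNReal.mul_rpow_of_nonneg _ _ (by positivity),
          ENNReal.mul_rpow_of_nonneg _ _ (by positivity), ← ENNReal.rpow_mul,
          mul_one_div_cancel hp0.ne', ENNReal.rpow_one, lpNormE, ← mul_assoc]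

end MaximalFunction

/-- Sharp `A₁` bound for the maximal operator `M'_{W,p}` built from reducing operators. -/
theorem a1_bound_MWpPrime (d n : ℕ) (hd : 1 ≤ d) (hn : 1 ≤ n) (p : ℝ) (hp : 1 < p) :
    ∃ c : ℝ≥0∞, 0 < c ∧ c ≠ ⊤ ∧
      ∀ W : Rd d → Mat n, IsMatrixWeight W → A1Const W ≠ ⊤ →
        ∀ R : Cube d → Mat n, IsReducingFamily W p R →
          ∀ f : Rd d → Vec n, MeasurableV f → lpNormV p f ≠ ⊤ →
            lpNormE p (MWpPrime R W p f) ≤ c * A1Const W ^ (1/p) * lpNormV p f := by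
  have hp0 : 0 < p := by linarith
  have hp1 : 0 < p - 1 := by linarith
  set C : ℝ≥0∞ := (d + 1) ^ d *
    (ENNReal.ofReal (p / (p - 1)) * (2 * 5 ^ d) * 2 ^ (p - 1)) ^ (1 / p) with hC
  have hCpos : C ≠ 0 := by
    have h1 : ENNReal.ofReal (p / (p - 1)) ≠ 0 := by
      rw [ne_eq, ENNReal.ofReal_eq_zero, not_le]
      positivity
    have h2 : (2 : ℝ≥0∞) ^ (p - 1) ≠ 0 := by simp [ENNReal.rpow_eq_zero_iff]
    refine mul_ne_zero (by positivity) ?_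
    rw [ne_eq, ENNReal.rpow_eq_zero_iff_of_pos (by positivity)]
    exact mul_ne_zero (mul_ne_zero h1 (by positivity)) h2
  have hCtop : C ≠ ⊤ := by
    refine ENNReal.mul_ne_top (by finiteness) (ENNReal.rpow_ne_top_of_nonneg (by positivity) ?_)
    finiteness
  have hsqrt : 0 < ENNReal.ofReal (Real.sqrt n) := by
    rw [ENNReal.ofReal_pos, Real.sqrt_pos]
    exact_mod_cast hn
  refine ⟨ENNReal.ofReal (Real.sqrt n) * C, ENNReal.mul_pos hsqrt.ne' hCpos,
    ENNReal.mul_ne_top ENNReal.ofReal_ne_top hCtop, fun W hW hA R hR f hf _ => ?_⟩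
  have hfm : Measurable f := (WithLp.measurable_toLp 2 (Fin n → ℂ)).comp (measurable_pi_iff.mpr hf)
  set B : ℝ≥0∞ := ENNReal.ofReal (Real.sqrt n) * A1Const W ^ (1 / p) with hB
  have hBtop : B ≠ ⊤ :=
    ENNReal.mul_ne_top ENNReal.ofReal_ne_top (ENNReal.rpow_ne_top_of_nonneg (by positivity) hA)
  set g : Rd d → ℝ≥0∞ := fun y => (‖f y‖₊ : ℝ≥0∞)
  calc lpNormE p (MWpPrime R W p f) ≤ (∫⁻ x, B ^ p * HLM g x ^ p) ^ (1 / p) := by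
        unfold lpNormE
        gcongr with x
        rw [← ENNReal.mul_rpow_of_nonneg _ _ hp0.le]
        gcongr
        exact MWpPrime_le hp hW.2 hA hR f x
    _ = B * lpNormE p (HLM g) := by
        rw [lintegral_const_mul' _ _ (ENNReal.rpow_ne_top_of_nonneg hp0.le hBtop),
          ENNReal.mul_rpow_of_nonneg _ _ (by positivity), ← ENNReal.rpow_mul,
          mul_one_div_cancel hp0.ne', ENNReal.rpow_one, lpNormE]
    _ ≤ B * (C * lpNormE p g) :=
        mul_le_mul' le_rfl (lpNormE_HLM_le hd hp hfm.nnnorm.coe_nnreal_ennreal)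
    _ = ENNReal.ofReal (Real.sqrt n) * C * A1Const W ^ (1 / p) * lpNormV p f := by
        change B * (C * lpNormV p f) = _
        rw [hB]
        ring

end
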